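/- Let m = 2n+1 and let A and B be the databases over the schema {R} (R binary) with A(R) = X ∪ Y ∪ Z where X = {1,…,m} × {2m+1}, Y = {2m+1} × {m+1,…,2m}, Z = {1,…,m} × {m+1,…,2m}, and B(R) = A(R) \ {((m+1)/2, m+(m+1)/2)}. Then A(R) is transitive, B(R) is not transitive, and the duplicator wins the n-round semijoin game SG_n⟨⟨⟩;⟨⟩⟩ on A and B (with vocabulary Ω = {=, <}); consequently transitivity is inexpressible in the semijoin algebra even on ordered databases. -/

import Mathlib

/-- Quantifier-free formulas over a vocabulary `Ω` of predicates (with arities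
given by `ωar`) and with equality built in, on `n` variables. -/
inductive QF (Ω : Type) (ωar : Ω → ℕ) : ℕ → Type
  | atom {n : ℕ} (p : Ω) (v : Fin (ωar p) → Fin n) : QF Ω ωar n
  | eq {n : ℕ} (i j : Fin n) : QF Ω ωar n
  | not {n : ℕ} : QF Ω ωar n → QF Ω ωar n
  | and {n : ℕ} : QF Ω ωar n → QF Ω ωar n → QF Ω ωar n
  | or {n : ℕ} : QF Ω ωar n → QF Ω ωar n → QF Ω ωar n

/-- Semantics of quantifier-free formulas, given an interpretation `I` of the
predicates of `Ω` over the universe `U`. -/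
def QF.holds {Ω : Type} {ωar : Ω → ℕ} {U : Type}
    (I : ∀ p : Ω, (Fin (ωar p) → U) → Prop) :
    ∀ {n : ℕ}, QF Ω ωar n → (Fin n → U) → Prop
  | _, .atom p v, t => I p (t ∘ v)
  | _, .eq i j, t => t i = t j
  | _, .not φ, t => ¬ QF.holds I φ t
  | _, .and φ ψ, t => QF.holds I φ t ∧ QF.holds I ψ t
  | _, .or φ ψ, t => QF.holds I φ t ∨ QF.holds I ψ t

/-- Quantifier-free formulas over the vocabulary `Ω = {=}` (equality only). -/
abbrev EqForm (n : ℕ) : Type := QF Empty (fun p => p.elim) n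

/-- Semantics of quantifier-free formulas over equality. -/
def EqForm.holds {U : Type} {n : ℕ} (θ : EqForm n) (t : Fin n → U) : Prop :=
  QF.holds (fun p => p.elim) θ t

/-- The semijoin algebra SA over a schema `S` (with arities `ar`) and vocabulary `Ω`
(with arities `ωar`, equality built in): expressions are built from relation names by
union and difference of equal-arity expressions, projection `π_X` (encoded by a
strictly monotone map of columns), selection `σ_θ`, and semijoin `E₁ ⋉_θ E₂`, where
selection and semijoin conditions `θ` are arbitrary quantifier-free formulas over
`Ω`. An expression is indexed by its arity. -/
inductive SA (S : Type) (ar : S → ℕ) (Ω : Type) (ωar : Ω → ℕ) : ℕ → Type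
  | rel (R : S) : SA S ar Ω ωar (ar R)
  | union {n : ℕ} : SA S ar Ω ωar n → SA S ar Ω ωar n → SA S ar Ω ωar n
  | diff {n : ℕ} : SA S ar Ω ωar n → SA S ar Ω ωar n → SA S ar Ω ωar n
  | proj {k n : ℕ} (f : Fin k → Fin n) (hf : StrictMono f) :
      SA S ar Ω ωar n → SA S ar Ω ωar k
  | sel {n : ℕ} (θ : QF Ω ωar n) : SA S ar Ω ωar n → SA S ar Ω ωar n
  | semijoin {n m : ℕ} (θ : QF Ω ωar (n + m)) :
      SA S ar Ω ωar n → SA S ar Ω ωar m → SA S ar Ω ωar n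

/-- Evaluation of an SA expression on a database `D`, given an interpretation `I`
of the predicates of `Ω` over the universe `U`. In the semijoin
`E₁ ⋉_θ E₂ = {ā ∈ E₁ ∣ ∃ b̄ ∈ E₂, θ(ā,b̄)}`, the condition `θ` is evaluated on the
concatenated tuple `(ā,b̄)`. -/
def SA.eval {S : Type} {ar : S → ℕ} {Ω : Type} {ωar : Ω → ℕ} {U : Type}
    (I : ∀ p : Ω, (Fin (ωar p) → U) → Prop)
    (D : ∀ R : S, Set (Fin (ar R) → U)) :
    ∀ {n : ℕ}, SA S ar Ω ωar n → Set (Fin n → U)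
  | _, .rel R => D R
  | _, .union E₁ E₂ => SA.eval I D E₁ ∪ SA.eval I D E₂
  | _, .diff E₁ E₂ => SA.eval I D E₁ \ SA.eval I D E₂
  | _, .proj f _ E => {t | ∃ a ∈ SA.eval I D E, t = a ∘ f}
  | _, .sel θ E => {a ∈ SA.eval I D E | QF.holds I θ a}
  | _, .semijoin θ E₁ E₂ =>
      {a ∈ SA.eval I D E₁ | ∃ b ∈ SA.eval I D E₂, QF.holds I θ (Fin.append a b)}

/-- Membership in the tuple space of a database: `t` is a projection (onto a strictly
increasing sequence of columns) of some tuple of some relation of `D`. -/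
def inTupleSpace {S : Type} {ar : S → ℕ} {U : Type}
    (D : ∀ R : S, Set (Fin (ar R) → U)) {k : ℕ} (t : Fin k → U) : Prop :=
  ∃ (R : S) (f : Fin k → Fin (ar R)), StrictMono f ∧ ∃ a ∈ D R, t = a ∘ f

/-- Condition (1) of the semijoin game: the tuples `a` and `b` belong to exactly the
same projections `π_X(A(R))` resp. `π_X(B(R))`. -/
def samePos {S : Type} {ar : S → ℕ} {U : Type}
    (A B : ∀ R : S, Set (Fin (ar R) → U)) {k : ℕ} (a b : Fin k → U) : Prop :=
  ∀ (R : S) (f : Fin k → Fin (ar R)), StrictMono f →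
    ((∃ t ∈ A R, a = t ∘ f) ↔ (∃ t ∈ B R, b = t ∘ f))

/-- Condition (2) of the semijoin game: the tuples `a` and `b` satisfy exactly the
same atomic formulas over the vocabulary `Ω` (equality included). -/
def sameAtomic {Ω : Type} {ωar : Ω → ℕ} {U : Type}
    (I : ∀ p : Ω, (Fin (ωar p) → U) → Prop) {k : ℕ} (a b : Fin k → U) : Prop :=
  (∀ i j : Fin k, a i = a j ↔ b i = b j) ∧
  ∀ (p : Ω) (v : Fin (ωar p) → Fin k), (I p (a ∘ v) ↔ I p (b ∘ v))

/-- The duplicator wins the `m`-round semijoin game on the databases `A` and `B`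
starting from the configuration `⟨a; b⟩`: the configuration satisfies the winning
conditions for the 0-round game, and (if `m > 0`) for every spoiler move (a tuple in
the tuple space of `A`, or of `B`) the duplicator has a legal answer in the other
tuple space from which he wins the game with one round less. -/
def DuplicatorWins {S : Type} {ar : S → ℕ} {Ω : Type} {ωar : Ω → ℕ} {U : Type}
    (A B : ∀ R : S, Set (Fin (ar R) → U))
    (I : ∀ p : Ω, (Fin (ωar p) → U) → Prop) :
    ℕ → ∀ {k : ℕ}, (Fin k → U) → (Fin k → U) → Prop
  | 0, _, a, b => samePos A B a b ∧ sameAtomic I a b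
  | m + 1, _, a, b =>
      (samePos A B a b ∧ sameAtomic I a b) ∧
      (∀ (l : ℕ) (c : Fin l → U), inTupleSpace A c →
        ∃ d : Fin l → U, inTupleSpace B d ∧ samePos A B c d ∧
          sameAtomic I (Fin.append a c) (Fin.append b d) ∧
          DuplicatorWins A B I m c d) ∧
      (∀ (l : ℕ) (d : Fin l → U), inTupleSpace B d →
        ∃ c : Fin l → U, inTupleSpace A c ∧ samePos A B c d ∧
          sameAtomic I (Fin.append a c) (Fin.append b d) ∧
          DuplicatorWins A B I m c d)

/-- The interpretation of the ordered vocabulary `Ω = {=, <}` over `ℕ` (encoded with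
`Ω = Unit` carrying the single binary predicate `<`, equality being built in). -/
def Iord : ∀ _ : Unit, (Fin 2 → ℕ) → Prop := fun _ t => t 0 < t 1

/-- The database `A` with `A(R) = X ∪ Y ∪ Z`, where, with `m = 2n+1`,
`X = {1,…,m} × {2m+1}`, `Y = {2m+1} × {m+1,…,2m}` and `Z = {1,…,m} × {m+1,…,2m}`. -/
def dbA (n : ℕ) : Set (Fin 2 → ℕ) :=
  {t | (1 ≤ t 0 ∧ t 0 ≤ 2 * n + 1 ∧ t 1 = 2 * (2 * n + 1) + 1) ∨
       (t 0 = 2 * (2 * n + 1) + 1 ∧ (2 * n + 1) + 1 ≤ t 1 ∧ t 1 ≤ 2 * (2 * n + 1)) ∨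
       (1 ≤ t 0 ∧ t 0 ≤ 2 * n + 1 ∧ (2 * n + 1) + 1 ≤ t 1 ∧ t 1 ≤ 2 * (2 * n + 1))}

/-- The database `B` with `B(R) = A(R) \ {((m+1)/2, m + (m+1)/2)}`; for `m = 2n+1`,
the removed pair is `(n+1, 3n+2)`. -/
def dbB (n : ℕ) : Set (Fin 2 → ℕ) :=
  dbA n \ {t | t 0 = n + 1 ∧ t 1 = 3 * n + 2}

/-! ### Games and expressions -/

section Game

variable {S : Type} {ar : S → ℕ} {Ω : Type} {ωar : Ω → ℕ} {U : Type}
  {A B : ∀ R : S, Set (Fin (ar R) → U)} {I : ∀ p : Ω, (Fin (ωar p) → U) → Prop}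

/-- The nesting depth of projections and semijoins of an expression: the number of rounds
of the game that the expression can be simulated with. -/
def SA.rank : ∀ {n : ℕ}, SA S ar Ω ωar n → ℕ
  | _, .rel _ => 0
  | _, .union E₁ E₂ => max E₁.rank E₂.rank
  | _, .diff E₁ E₂ => max E₁.rank E₂.rank
  | _, .proj _ _ E => E.rank + 1
  | _, .sel _ E => E.rank
  | _, .semijoin _ E₁ E₂ => max E₁.rank (E₂.rank + 1)

theorem SA.inTupleSpace_of_mem_eval {n : ℕ} (E : SA S ar Ω ωar n) {t : Fin n → U}
    (ht : t ∈ E.eval I A) : inTupleSpace A t := by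
  induction E with
  | rel R => exact ⟨R, id, strictMono_id, t, ht, rfl⟩
  | union E₁ E₂ ih₁ ih₂ => exact ht.elim ih₁ ih₂
  | diff E₁ E₂ ih₁ ih₂ => exact ih₁ ht.1
  | proj f hf E ih =>
    obtain ⟨a, ha, rfl⟩ := ht
    obtain ⟨R, g, hg, b, hb, rfl⟩ := ih ha
    exact ⟨R, g ∘ f, hg.comp hf, b, hb, rfl⟩
  | sel θ E ih => exact ih ht.1
  | semijoin θ E₁ E₂ ih₁ ih₂ => exact ih₁ ht.1

theorem sameAtomic.holds_iff {k : ℕ} {a b : Fin k → U} (h : sameAtomic I a b)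
    (θ : QF Ω ωar k) : θ.holds I a ↔ θ.holds I b := by
  induction θ with
  | atom p v => simpa only [QF.holds] using h.2 p v
  | eq i j => simpa only [QF.holds] using h.1 i j
  | not φ ih => simpa only [QF.holds] using not_congr ih
  | and φ ψ ih₁ ih₂ => simpa only [QF.holds] using and_congr ih₁ ih₂
  | or φ ψ ih₁ ih₂ => simpa only [QF.holds] using or_congr ih₁ ih₂

theorem sameAtomic.comp_eq_iff {k l : ℕ} {a b : Fin k → U} {c d : Fin l → U}
    (h : sameAtomic I (Fin.append a c) (Fin.append b d)) (f : Fin k → Fin l) :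
    a = c ∘ f ↔ b = d ∘ f := by
  simp only [funext_iff, Function.comp_apply]
  refine forall_congr' fun i => ?_
  simpa using h.1 (Fin.castAdd l i) (Fin.natAdd k (f i))

theorem DuplicatorWins.samePos_and_sameAtomic {m k : ℕ} {a b : Fin k → U}
    (h : DuplicatorWins A B I m a b) : samePos A B a b ∧ sameAtomic I a b := by
  cases m with
  | zero => exact h
  | succ m => exact h.1

theorem DuplicatorWins.of_succ {m : ℕ} : ∀ {k : ℕ} {a b : Fin k → U},
    DuplicatorWins A B I (m + 1) a b → DuplicatorWins A B I m a b := by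
  induction m with
  | zero => exact fun h => h.1
  | succ m ih =>
    refine fun h => ⟨h.1, fun l c hc => ?_, fun l d hd => ?_⟩
    · obtain ⟨d, h₁, h₂, h₃, h₄⟩ := h.2.1 l c hc
      exact ⟨d, h₁, h₂, h₃, ih h₄⟩
    · obtain ⟨c, h₁, h₂, h₃, h₄⟩ := h.2.2 l d hd
      exact ⟨c, h₁, h₂, h₃, ih h₄⟩

theorem DuplicatorWins.mono {m r k : ℕ} {a b : Fin k → U} (hr : r ≤ m)
    (h : DuplicatorWins A B I m a b) : DuplicatorWins A B I r a b := by
  induction hr with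
  | refl => exact h
  | step _ ih => exact ih h.of_succ

theorem DuplicatorWins.mem_eval_iff {n : ℕ} (E : SA S ar Ω ωar n) :
    ∀ {a b : Fin n → U}, DuplicatorWins A B I E.rank a b →
      (a ∈ E.eval I A ↔ b ∈ E.eval I B) := by
  induction E with
  | rel R =>
    intro a b h
    simpa [SA.eval] using h.samePos_and_sameAtomic.1 R id strictMono_id
  | union E₁ E₂ ih₁ ih₂ =>
    exact fun h => or_congr (ih₁ (h.mono (le_max_left _ _))) (ih₂ (h.mono (le_max_right _ _)))
  | diff E₁ E₂ ih₁ ih₂ =>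
    exact fun h => and_congr (ih₁ (h.mono (le_max_left _ _)))
      (not_congr (ih₂ (h.mono (le_max_right _ _))))
  | proj f hf E ih =>
    intro a b h
    constructor
    · rintro ⟨c, hc, hac⟩
      obtain ⟨d, -, -, hat, hw⟩ := h.2.1 _ c (E.inTupleSpace_of_mem_eval hc)
      exact ⟨d, (ih hw).1 hc, (hat.comp_eq_iff f).1 hac⟩
    · rintro ⟨d, hd, hbd⟩
      obtain ⟨c, -, -, hat, hw⟩ := h.2.2 _ d (E.inTupleSpace_of_mem_eval hd)
      exact ⟨c, (ih hw).2 hd, (hat.comp_eq_iff f).2 hbd⟩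
  | sel θ E ih =>
    exact fun h => and_congr (ih h) (h.samePos_and_sameAtomic.2.holds_iff θ)
  | semijoin θ E₁ E₂ ih₁ ih₂ =>
    intro a b h
    refine and_congr (ih₁ (h.mono (le_max_left _ _))) ?_
    have h' := h.mono (le_max_right E₁.rank (E₂.rank + 1))
    constructor
    · rintro ⟨c, hc, hθ⟩
      obtain ⟨d, -, -, hat, hw⟩ := h'.2.1 _ c (E₂.inTupleSpace_of_mem_eval hc)
      exact ⟨d, (ih₂ hw).1 hc, (hat.holds_iff θ).1 hθ⟩
    · rintro ⟨d, hd, hθ⟩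
      obtain ⟨c, -, -, hat, hw⟩ := h'.2.2 _ d (E₂.inTupleSpace_of_mem_eval hd)
      exact ⟨c, (ih₂ hw).2 hd, (hat.holds_iff θ).2 hθ⟩

end Game

theorem sameAtomic_Iord_of_lt_iff {k : ℕ} {a b : Fin k → ℕ}
    (h : ∀ i j, a i < a j ↔ b i < b j) : sameAtomic Iord a b := by
  refine ⟨fun i j => ?_, fun _ v => h (v 0) (v 1)⟩
  have h₁ := h i j
  have h₂ := h j i
  omega

/-! ### The two databases -/

/-- The values `u ∈ {1,…,m}`, `m + v ∈ {m+1,…,2m}` and `2m+1`, where `m = 2n+1`. -/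
def triple (n u v : ℕ) : Fin 3 → ℕ := ![u, 2 * n + 1 + v, 2 * (2 * n + 1) + 1]

/-- The patterns according to which the tuples of `X`, `Y` and `Z` select from a triple. -/
def IsPattern (σ : Fin 2 → Fin 3) : Prop := σ = ![0, 2] ∨ σ = ![2, 1] ∨ σ = ![0, 1]

/-- Pairs of positions in the two linear orders of length `m = 2n+1`. -/
def IsPosition (n u v : ℕ) : Prop := (1 ≤ u ∧ u ≤ 2 * n + 1) ∧ 1 ≤ v ∧ v ≤ 2 * n + 1

/-- The pair of middle positions, which is removed in `dbB n`. -/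
def IsCenter (n u v : ℕ) : Prop := u = n + 1 ∧ v = n + 1

theorem mem_dbA_iff {n : ℕ} {t : Fin 2 → ℕ} :
    t ∈ dbA n ↔ ∃ u v, IsPosition n u v ∧ ∃ σ, IsPattern σ ∧ t = triple n u v ∘ σ := by
  constructor
  · rintro (h | h | h)
    · exact ⟨t 0, 1, ⟨⟨h.1, h.2.1⟩, by omega⟩, _, .inl rfl,
        by ext i; fin_cases i <;> simp [triple, h.2.2]⟩
    · exact ⟨1, t 1 - (2 * n + 1), ⟨by omega, by omega⟩, _, .inr (.inl rfl),
        by ext i; fin_cases i <;> simp [triple] <;> omega⟩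
    · exact ⟨t 0, t 1 - (2 * n + 1), ⟨by omega, by omega⟩, _, .inr (.inr rfl),
        by ext i; fin_cases i <;> simp [triple] <;> omega⟩
  · rintro ⟨u, v, ⟨hu, hv⟩, σ, rfl | rfl | rfl, rfl⟩ <;>
      simp [dbA, triple] <;> omega

theorem triple_comp_mem_dbB {n u v : ℕ} (h : IsPosition n u v) (hc : ¬ IsCenter n u v)
    {σ : Fin 2 → Fin 3} (hσ : IsPattern σ) : triple n u v ∘ σ ∈ dbB n := by
  refine ⟨mem_dbA_iff.2 ⟨u, v, h, σ, hσ, rfl⟩, ?_⟩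
  unfold IsPosition IsCenter at *
  rcases hσ with rfl | rfl | rfl <;> simp [triple] <;> omega

theorem exists_of_mem_dbB {n : ℕ} (hn : 0 < n) {t : Fin 2 → ℕ} (ht : t ∈ dbB n) :
    ∃ u v, IsPosition n u v ∧ ¬ IsCenter n u v ∧
      ∃ σ, IsPattern σ ∧ t = triple n u v ∘ σ := by
  obtain ⟨h | h | h, hc⟩ := ht
  · exact ⟨t 0, 1, ⟨⟨h.1, h.2.1⟩, by omega⟩, fun h' => by have := h'.2; omega, _, .inl rfl,
      by ext i; fin_cases i <;> simp [triple, h.2.2]⟩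
  · exact ⟨1, t 1 - (2 * n + 1), ⟨by omega, by omega⟩, fun h' => by have := h'.1; omega, _,
      .inr (.inl rfl), by ext i; fin_cases i <;> simp [triple] <;> omega⟩
  · refine ⟨t 0, t 1 - (2 * n + 1), ⟨by omega, by omega⟩, fun h' => hc ⟨h'.1, ?_⟩, _,
      .inr (.inr rfl), by ext i; fin_cases i <;> simp [triple] <;> omega⟩
    have := h'.2
    omega

theorem triple_eq_imp {n u v u' v' : ℕ} (h : IsPosition n u v) (h' : IsPosition n u' v')
    {p q : Fin 3} (hpq : triple n u v p = triple n u' v' q) : p = q := by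
  unfold IsPosition at *
  fin_cases p <;> fin_cases q <;> simp [triple] at hpq ⊢ <;> omega

theorem exists_mem_dbA_comp_iff {n u v k : ℕ} (h : IsPosition n u v) (ρ : Fin k → Fin 3)
    (f : Fin k → Fin 2) :
    (∃ t ∈ dbA n, triple n u v ∘ ρ = t ∘ f) ↔ ∃ σ, IsPattern σ ∧ ρ = σ ∘ f := by
  constructor
  · rintro ⟨t, ht, hρ⟩
    obtain ⟨u', v', h', σ, hσ, rfl⟩ := mem_dbA_iff.1 ht
    exact ⟨σ, hσ, funext fun i => triple_eq_imp h h' (congrFun hρ i)⟩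
  · rintro ⟨σ, hσ, rfl⟩
    exact ⟨_, mem_dbA_iff.2 ⟨u, v, h, σ, hσ, rfl⟩, rfl⟩

theorem exists_mem_dbB_comp_iff {n u v k : ℕ} (h : IsPosition n u v) (hc : ¬ IsCenter n u v)
    (ρ : Fin k → Fin 3) (f : Fin k → Fin 2) :
    (∃ t ∈ dbB n, triple n u v ∘ ρ = t ∘ f) ↔ ∃ σ, IsPattern σ ∧ ρ = σ ∘ f := by
  constructor
  · rintro ⟨t, ht, hρ⟩
    exact (exists_mem_dbA_comp_iff h ρ f).1 ⟨t, ht.1, hρ⟩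
  · rintro ⟨σ, hσ, rfl⟩
    exact ⟨_, triple_comp_mem_dbB h hc hσ, rfl⟩

theorem samePos_triple {n u v u' v' k : ℕ} (h : IsPosition n u v) (h' : IsPosition n u' v')
    (hc : ¬ IsCenter n u' v') (ρ : Fin k → Fin 3) :
    samePos (S := Unit) (ar := fun _ => 2) (fun _ => dbA n) (fun _ => dbB n)
      (triple n u v ∘ ρ) (triple n u' v' ∘ ρ) :=
  fun _ f _ => (exists_mem_dbA_comp_iff h ρ f).trans (exists_mem_dbB_comp_iff h' hc ρ f).symm

theorem dbA_finite (n : ℕ) : (dbA n).Finite := by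
  refine (Set.finite_Icc (0 : Fin 2 → ℕ) fun _ => 4 * n + 3).subset fun t ht => ?_
  refine ⟨fun i => Nat.zero_le _, fun i => ?_⟩
  rcases ht with h | h | h <;> fin_cases i <;> simp <;> omega

theorem dbA_transitive (n : ℕ) :
    ∀ s ∈ dbA n, ∀ t ∈ dbA n, s 1 = t 0 → ![s 0, t 1] ∈ dbA n := by
  intro s hs t ht hst
  simp only [dbA, Set.mem_ofPred_eq] at hs ht
  simp [dbA]
  omega

theorem dbB_not_transitive (n : ℕ) :
    ¬ ∀ s ∈ dbB n, ∀ t ∈ dbB n, s 1 = t 0 → ![s 0, t 1] ∈ dbB n := by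
  intro h
  refine (h ![n + 1, 2 * (2 * n + 1) + 1] ?_ ![2 * (2 * n + 1) + 1, 3 * n + 2] ?_ rfl).2
    ⟨rfl, rfl⟩ <;> simp [dbB, dbA] <;> omega

/-! ### The strategy of the duplicator -/

/-- Two positions that are indistinguishable with `k` rounds to go: they are equal, or both
have distance at least `k` from the ends. -/
def Near (n k x x' : ℕ) : Prop :=
  x = x' ∨ (k < x ∧ x + k ≤ 2 * n + 1) ∧ k < x' ∧ x' + k ≤ 2 * n + 1

theorem Near.symm {n k x x' : ℕ} (h : Near n k x x') : Near n k x' x :=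
  h.imp Eq.symm And.symm

/-- The pairs `x, u` and `x', u'` are ordered in the same way. -/
def SameOrder (x u x' u' : ℕ) : Prop := (x < u ↔ x' < u') ∧ (u < x ↔ u' < x')

theorem SameOrder.symm {x u x' u' : ℕ} (h : SameOrder x u x' u') : SameOrder x' u' x u :=
  ⟨h.1.symm, h.2.symm⟩

theorem Near.exists_answer {n k x x' u : ℕ} (hk : k < n) (h : Near n (k + 1) x x')
    (hx' : 1 ≤ x' ∧ x' ≤ 2 * n + 1) (hu : 1 ≤ u ∧ u ≤ 2 * n + 1) :
    ∃ u', (1 ≤ u' ∧ u' ≤ 2 * n + 1) ∧ Near n k u u' ∧ SameOrder x u x' u' ∧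
      (x' ≠ n + 1 → u' ≠ n + 1) := by
  unfold Near SameOrder at *
  rcases eq_or_ne u x with rfl | hux
  · exact ⟨x', by omega⟩
  · by_cases hmid : k < u ∧ u + k ≤ 2 * n + 1
    · rcases lt_or_gt_of_ne hux with hlt | hgt
      · exact ⟨k + 1, by omega⟩
      · exact ⟨2 * n + 1 - k, by omega⟩
    · exact ⟨u, by omega⟩

theorem sameAtomic_append_triple {n x y x' y' u v u' v' k l : ℕ}
    (hx : IsPosition n x y) (hx' : IsPosition n x' y')
    (hu : IsPosition n u v) (hu' : IsPosition n u' v')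
    (h₁ : SameOrder x u x' u') (h₂ : SameOrder y v y' v')
    (ρ : Fin k → Fin 3) (τ : Fin l → Fin 3) :
    sameAtomic Iord (Fin.append (triple n x y ∘ ρ) (triple n u v ∘ τ))
      (Fin.append (triple n x' y' ∘ ρ) (triple n u' v' ∘ τ)) := by
  have self {u v u' v' : ℕ} (hu : IsPosition n u v) (hu' : IsPosition n u' v') (p q : Fin 3) :
      triple n u v p < triple n u v q ↔ triple n u' v' p < triple n u' v' q := by
    unfold IsPosition at *
    fin_cases p <;> fin_cases q <;> simp [triple] <;> omega
  unfold SameOrder at *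
  refine sameAtomic_Iord_of_lt_iff fun i j => ?_
  refine Fin.addCases (fun i => ?_) (fun i => ?_) i <;>
    refine Fin.addCases (fun j => ?_) (fun j => ?_) j <;>
    simp only [Fin.append_left, Fin.append_right, Function.comp_apply]
  · exact self hx hx' _ _
  · generalize ρ i = p
    generalize τ j = q
    unfold IsPosition at *
    fin_cases p <;> fin_cases q <;> simp [triple] <;> omega
  · generalize τ i = p
    generalize ρ j = q
    unfold IsPosition at *
    fin_cases p <;> fin_cases q <;> simp [triple] <;> omega
  · exact self hu hu' _ _

theorem sameAtomic_triple {n u v u' v' l : ℕ} (hu : IsPosition n u v) (hu' : IsPosition n u' v')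
    (τ : Fin l → Fin 3) : sameAtomic Iord (triple n u v ∘ τ) (triple n u' v' ∘ τ) := by
  refine sameAtomic_Iord_of_lt_iff fun i j => ?_
  simp only [Function.comp_apply]
  generalize τ i = p
  generalize τ j = q
  unfold IsPosition at *
  fin_cases p <;> fin_cases q <;> simp [triple] <;> omega

theorem duplicatorWins_triple {n : ℕ} (k : ℕ) (hk : k ≤ n) :
    ∀ {l x y x' y' : ℕ} (ρ : Fin l → Fin 3), IsPosition n x y → IsPosition n x' y' →
      ¬ IsCenter n x' y' → Near n k x x' → Near n k y y' →
      DuplicatorWins (S := Unit) (ar := fun _ => 2) (fun _ => dbA n) (fun _ => dbB n) Iord k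
        (triple n x y ∘ ρ) (triple n x' y' ∘ ρ) := by
  induction k with
  | zero =>
    exact fun ρ h h' hc _ _ => ⟨samePos_triple h h' hc ρ, sameAtomic_triple h h' ρ⟩
  | succ k ih =>
    intro l x y x' y' ρ h h' hc hx hy
    refine ⟨⟨samePos_triple h h' hc ρ, sameAtomic_triple h h' ρ⟩, ?_, ?_⟩
    · rintro l c ⟨R, f, hf, a, ha, rfl⟩
      obtain ⟨u, v, huv, σ, hσ, rfl⟩ := mem_dbA_iff.1 ha
      obtain ⟨u', hu', hnu, hou, hcu⟩ := hx.exists_answer hk h'.1 huv.1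
      obtain ⟨v', hv', hnv, hov, hcv⟩ := hy.exists_answer hk h'.2 huv.2
      have huv' : IsPosition n u' v' := ⟨hu', hv'⟩
      have hc' : ¬ IsCenter n u' v' := fun hcen =>
        hc ⟨by_contra fun hne => hcu hne hcen.1, by_contra fun hne => hcv hne hcen.2⟩
      exact ⟨triple n u' v' ∘ σ ∘ f, ⟨R, f, hf, _, triple_comp_mem_dbB huv' hc' hσ, rfl⟩,
        samePos_triple huv huv' hc' (σ ∘ f),
        sameAtomic_append_triple h h' huv huv' hou hov ρ (σ ∘ f),
        ih (by omega) (σ ∘ f) huv huv' hc' hnu hnv⟩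
    · rintro l d ⟨R, f, hf, b, hb, rfl⟩
      obtain ⟨u', v', huv', hc', σ, hσ, rfl⟩ := exists_of_mem_dbB (by omega) hb
      obtain ⟨u, hu, hnu, hou, -⟩ := hx.symm.exists_answer hk h.1 huv'.1
      obtain ⟨v, hv, hnv, hov, -⟩ := hy.symm.exists_answer hk h.2 huv'.2
      have huv : IsPosition n u v := ⟨hu, hv⟩
      exact ⟨triple n u v ∘ σ ∘ f,
        ⟨R, f, hf, _, mem_dbA_iff.2 ⟨u, v, huv, σ, hσ, rfl⟩, rfl⟩,
        samePos_triple huv huv' hc' (σ ∘ f),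
        sameAtomic_append_triple h h' huv huv' hou.symm hov.symm ρ (σ ∘ f),
        ih (by omega) (σ ∘ f) huv huv' hc' hnu.symm hnv.symm⟩

theorem duplicatorWins_elim0 (n : ℕ) :
    DuplicatorWins (S := Unit) (ar := fun _ => 2)
      (fun _ : Unit => dbA n) (fun _ : Unit => dbB n) Iord n
      (fun i : Fin 0 => i.elim0) (fun i : Fin 0 => i.elim0) := by
  rcases Nat.eq_zero_or_pos n with rfl | hn
  · refine ⟨fun _ f _ => iff_of_true ?_ ?_, sameAtomic_Iord_of_lt_iff fun i => i.elim0⟩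
    · exact ⟨![1, 3], by simp [dbA], funext fun i => i.elim0⟩
    · exact ⟨![1, 3], by simp [dbB, dbA], funext fun i => i.elim0⟩
  · have h : IsPosition n 1 1 := by unfold IsPosition; omega
    have hc : ¬ IsCenter n 1 1 := by unfold IsCenter; omega
    convert duplicatorWins_triple n le_rfl Fin.elim0 h h hc (.inl rfl) (.inl rfl) using 1

/-- With `m = 2n+1` and the databases `A`, `B` as above: `A(R)` is
transitive, `B(R)` is not transitive, and the duplicator wins the `n`-round semijoin
game `SG_n⟨⟨⟩;⟨⟩⟩` on `A` and `B` (with vocabulary `Ω = {=, <}`); consequently,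
transitivity is inexpressible in the semijoin algebra even on ordered databases. -/
theorem stmt13 (n : ℕ) :
    (∀ s ∈ dbA n, ∀ t ∈ dbA n, s 1 = t 0 → ![s 0, t 1] ∈ dbA n) ∧
    ¬ (∀ s ∈ dbB n, ∀ t ∈ dbB n, s 1 = t 0 → ![s 0, t 1] ∈ dbB n) ∧
    DuplicatorWins (S := Unit) (ar := fun _ => 2)
      (fun _ : Unit => dbA n) (fun _ : Unit => dbB n) Iord n
      (fun i : Fin 0 => i.elim0) (fun i : Fin 0 => i.elim0) ∧
    ¬ ∃ E : SA Unit (fun _ => 2) Unit (fun _ => 2) 0,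
        ∀ D : Set (Fin 2 → ℕ), D.Finite →
          (((E.eval Iord (fun _ : Unit => D)).Nonempty) ↔
            ∀ s ∈ D, ∀ t ∈ D, s 1 = t 0 → ![s 0, t 1] ∈ D) := by
  refine ⟨dbA_transitive n, dbB_not_transitive n, duplicatorWins_elim0 n, ?_⟩
  rintro ⟨E, hE⟩
  obtain ⟨t, ht⟩ := (hE _ (dbA_finite E.rank)).2 (dbA_transitive E.rank)
  rw [Subsingleton.elim t (fun i : Fin 0 => i.elim0)] at ht
  have hB := (duplicatorWins_elim0 E.rank).mem_eval_iff.1 ht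
  exact dbB_not_transitive E.rank
    ((hE _ ((dbA_finite E.rank).subset Set.sdiff_subset)).1 ⟨_, hB⟩)
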